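/- Weak representation theorem for ES fusion operators: an ES combination operator ∇ on an epistemic space (ℰ, B, ℒ_𝒫) is an ES fusion operator (i.e., satisfies (ESF1)–(ESF8)) if and only if there exists a unique faithful assignment Φ ↦ ≽_Φ that represents ∇, i.e., such that [B(∇(Φ,E))] = max([B(E)], ≽_Φ) for every profile Φ and every epistemic state E. -/

import Mathlib

/- Common framework for logic-based merging of epistemic states
   (Mata Díaz & Pino Pérez, "Impossibility in Belief Merging"). -/

namespace BeliefMerging

/-- A profile: a nonempty finite society of agents together with an
assignment of an epistemic state to each agent of the society. -/
structure Profile (S ℰ : Type) where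
  soc : Finset S
  soc_nonempty : soc.Nonempty
  val : {x // x ∈ soc} → ℰ

variable {S ℰ W : Type}

/-- The singleton profile of agent `i` with epistemic state `E`. -/
def Profile.single (i : S) (E : ℰ) : Profile S ℰ :=
  ⟨{i}, Finset.singleton_nonempty i, fun _ => E⟩

/-- Restriction of a profile to a nonempty subsociety. -/
def Profile.restrict (Φ : Profile S ℰ) (M : Finset S) (hM : M.Nonempty)
    (hsub : M ⊆ Φ.soc) : Profile S ℰ :=
  ⟨M, hM, fun i => Φ.val ⟨i.1, hsub i.2⟩⟩

/-- Equivalence of profiles: societies of the same cardinality whose states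
correspond under the unique order-preserving bijection. -/
def Profile.Equiv [LinearOrder S] (Φ Ψ : Profile S ℰ) : Prop :=
  ∃ h : Φ.soc.card = Ψ.soc.card,
    ∀ k : Fin Φ.soc.card,
      Φ.val (Φ.soc.orderIsoOfFin rfl k) = Ψ.val (Ψ.soc.orderIsoOfFin h.symm k)

/-- (ESF1) -/
def ESF1 (B : ℰ → Set W) (nab : Profile S ℰ → ℰ → ℰ) : Prop :=
  ∀ (Φ : Profile S ℰ) (E : ℰ), B (nab Φ E) ⊆ B E

/-- (ESF2) -/
def ESF2 [LinearOrder S] (B : ℰ → Set W) (nab : Profile S ℰ → ℰ → ℰ) : Prop :=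
  ∀ (Φ Φ' : Profile S ℰ) (E E' : ℰ), Profile.Equiv Φ Φ' → B E = B E' →
    B (nab Φ E) = B (nab Φ' E')

/-- (ESF3) -/
def ESF3 (B : ℰ → Set W) (nab : Profile S ℰ → ℰ → ℰ) : Prop :=
  ∀ (Φ : Profile S ℰ) (E E' E'' : ℰ), B E = B E' ∩ B E'' →
    B (nab Φ E') ∩ B E'' ⊆ B (nab Φ E)

/-- (ESF4) -/
def ESF4 (B : ℰ → Set W) (nab : Profile S ℰ → ℰ → ℰ) : Prop :=
  ∀ (Φ : Profile S ℰ) (E E' E'' : ℰ), B E = B E' ∩ B E'' →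
    (B (nab Φ E') ∩ B E'').Nonempty →
    B (nab Φ E) ⊆ B (nab Φ E') ∩ B E''

/-- ES basic fusion operator: (ESF1)–(ESF4). -/
def BasicFusion [LinearOrder S] (B : ℰ → Set W) (nab : Profile S ℰ → ℰ → ℰ) : Prop :=
  ESF1 B nab ∧ ESF2 B nab ∧ ESF3 B nab ∧ ESF4 B nab

/-- (ESF5) -/
def ESF5 (B : ℰ → Set W) (nab : Profile S ℰ → ℰ → ℰ) : Prop :=
  ∀ (j k : S) (Ej Ek : ℰ), Ej ≠ Ek →
    ∃ E' : ℰ, B (nab (Profile.single j Ej) E') ≠ B (nab (Profile.single k Ek) E')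

/-- (ESF6) -/
def ESF6 (B : ℰ → Set W) (nab : Profile S ℰ → ℰ → ℰ) : Prop :=
  ∀ (Φ : Profile S ℰ) (E : ℰ),
    ((⋂ i : {x // x ∈ Φ.soc}, B (Φ.val i)) ∩ B E).Nonempty →
    B (nab Φ E) = (⋂ i : {x // x ∈ Φ.soc}, B (Φ.val i)) ∩ B E

/-- (ESF7) -/
def ESF7 [DecidableEq S] (B : ℰ → Set W) (nab : Profile S ℰ → ℰ → ℰ) : Prop :=
  ∀ (Φ : Profile S ℰ) (N₁ N₂ : Finset S) (h₁ : N₁.Nonempty) (h₂ : N₂.Nonempty)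
    (hs₁ : N₁ ⊆ Φ.soc) (hs₂ : N₂ ⊆ Φ.soc),
    Disjoint N₁ N₂ → N₁ ∪ N₂ = Φ.soc → ∀ E : ℰ,
      B (nab (Φ.restrict N₁ h₁ hs₁) E) ∩ B (nab (Φ.restrict N₂ h₂ hs₂) E) ⊆
        B (nab Φ E)

/-- (ESF8) -/
def ESF8 [DecidableEq S] (B : ℰ → Set W) (nab : Profile S ℰ → ℰ → ℰ) : Prop :=
  ∀ (Φ : Profile S ℰ) (N₁ N₂ : Finset S) (h₁ : N₁.Nonempty) (h₂ : N₂.Nonempty)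
    (hs₁ : N₁ ⊆ Φ.soc) (hs₂ : N₂ ⊆ Φ.soc),
    Disjoint N₁ N₂ → N₁ ∪ N₂ = Φ.soc → ∀ E : ℰ,
      (B (nab (Φ.restrict N₁ h₁ hs₁) E) ∩ B (nab (Φ.restrict N₂ h₂ hs₂) E)).Nonempty →
      B (nab Φ E) ⊆
        B (nab (Φ.restrict N₁ h₁ hs₁) E) ∩ B (nab (Φ.restrict N₂ h₂ hs₂) E)

/-- (ESF8W) -/
def ESF8W [DecidableEq S] (B : ℰ → Set W) (nab : Profile S ℰ → ℰ → ℰ) : Prop :=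
  ∀ (Φ : Profile S ℰ) (N₁ N₂ : Finset S) (h₁ : N₁.Nonempty) (h₂ : N₂.Nonempty)
    (hs₁ : N₁ ⊆ Φ.soc) (hs₂ : N₂ ⊆ Φ.soc),
    Disjoint N₁ N₂ → N₁ ∪ N₂ = Φ.soc → ∀ E : ℰ,
      (B (nab (Φ.restrict N₁ h₁ hs₁) E) ∩ B (nab (Φ.restrict N₂ h₂ hs₂) E)).Nonempty →
      B (nab Φ E) ⊆
        B (nab (Φ.restrict N₁ h₁ hs₁) E) ∪ B (nab (Φ.restrict N₂ h₂ hs₂) E)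

/-- ES fusion operator: (ESF1)–(ESF8). -/
def Fusion [LinearOrder S] (B : ℰ → Set W) (nab : Profile S ℰ → ℰ → ℰ) : Prop :=
  BasicFusion B nab ∧ ESF5 B nab ∧ ESF6 B nab ∧ ESF7 B nab ∧ ESF8 B nab

/-- ES quasifusion operator: (ESF1)–(ESF7) and (ESF8W). -/
def Quasifusion [LinearOrder S] (B : ℰ → Set W) (nab : Profile S ℰ → ℰ → ℰ) : Prop :=
  BasicFusion B nab ∧ ESF5 B nab ∧ ESF6 B nab ∧ ESF7 B nab ∧ ESF8W B nab

/-- (ESF-SD), Standard Domain. -/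
def ESFSD (B : ℰ → Set W) (nab : Profile S ℰ → ℰ → ℰ) : Prop :=
  ∀ (i : S) (w w' w'' : W), w ≠ w' → w ≠ w'' → w' ≠ w'' →
  ∀ (E₁ E₂ : ℰ), B E₁ = {w, w'} → B E₂ = {w', w''} →
    (∃ Ei : ℰ, B (nab (Profile.single i Ei) E₁) = {w, w'} ∧
               B (nab (Profile.single i Ei) E₂) = {w', w''}) ∧
    (∃ Ei : ℰ, B (nab (Profile.single i Ei) E₁) = {w, w'} ∧
               B (nab (Profile.single i Ei) E₂) = {w'}) ∧
    (∃ Ei : ℰ, B (nab (Profile.single i Ei) E₁) = {w} ∧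
               B (nab (Profile.single i Ei) E₂) = {w', w''}) ∧
    (∃ Ei : ℰ, B (nab (Profile.single i Ei) E₁) = {w} ∧
               B (nab (Profile.single i Ei) E₂) = {w'})

/-- (ESF-U), Unanimity. -/
def ESFU (B : ℰ → Set W) (nab : Profile S ℰ → ℰ → ℰ) : Prop :=
  ∀ (Φ : Profile S ℰ), (∀ i j : {x // x ∈ Φ.soc}, Φ.val i = Φ.val j) →
    ∀ (E : ℰ) (i : {x // x ∈ Φ.soc}),
      B (nab Φ E) = B (nab (Profile.single i.1 (Φ.val i)) E)

/-- (ESF-P), Pareto. -/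
def ESFP (B : ℰ → Set W) (nab : Profile S ℰ → ℰ → ℰ) : Prop :=
  ∀ (Φ : Profile S ℰ) (E E' : ℰ),
    (⋂ i : {x // x ∈ Φ.soc}, B (nab (Profile.single i.1 (Φ.val i)) E)).Nonempty →
    (∀ i : {x // x ∈ Φ.soc}, B (nab (Profile.single i.1 (Φ.val i)) E) ∩ B E' = ∅) →
    B (nab Φ E) ∩ B E' = ∅

/-- (ESF-I), Independence. -/
def ESFI (B : ℰ → Set W) (nab : Profile S ℰ → ℰ → ℰ) : Prop :=
  ∀ (N : Finset S) (hN : N.Nonempty) (f g : {x // x ∈ N} → ℰ) (E : ℰ),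
    (∀ E' : ℰ, B E' ⊆ B E → ∀ j : {x // x ∈ N},
      B (nab (Profile.single j.1 (f j)) E') = B (nab (Profile.single j.1 (g j)) E')) →
    B (nab ⟨N, hN, f⟩ E) = B (nab ⟨N, hN, g⟩ E)

/-- (ESF-D), Dictator. -/
def ESFD (B : ℰ → Set W) (nab : Profile S ℰ → ℰ → ℰ) : Prop :=
  ∀ (N : Finset S) (hN : N.Nonempty), ∃ d : {x // x ∈ N},
    ∀ (f : {x // x ∈ N} → ℰ) (E : ℰ),
      B (nab ⟨N, hN, f⟩ E) ⊆ B (nab (Profile.single d.1 (f d)) E)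

/-- The maximal elements of `C` with respect to the total preorder `R`. -/
def MaxSet (C : Set W) (R : W → W → Prop) : Set W :=
  {w ∈ C | ∀ w' ∈ C, R w w'}

/-- The strict part of a total preorder. -/
def StrictRel (R : W → W → Prop) (a b : W) : Prop := R a b ∧ ¬ R b a

/-- An assignment: each profile is mapped to a total preorder over valuations. -/
def IsAssignment (f : Profile S ℰ → W → W → Prop) : Prop :=
  ∀ Φ : Profile S ℰ, (∀ a b : W, f Φ a b ∨ f Φ b a) ∧
    (∀ a b c : W, f Φ a b → f Φ b c → f Φ a c)

/-- A basic assignment: an assignment sending equivalent profiles to equal preorders. -/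
def IsBasicAssignment [LinearOrder S] (f : Profile S ℰ → W → W → Prop) : Prop :=
  IsAssignment f ∧ ∀ Φ Ψ : Profile S ℰ, Profile.Equiv Φ Ψ → f Φ = f Ψ

/-- The assignment `f` represents the operator `nab`. -/
def Represents (B : ℰ → Set W) (nab : Profile S ℰ → ℰ → ℰ)
    (f : Profile S ℰ → W → W → Prop) : Prop :=
  ∀ (Φ : Profile S ℰ) (E : ℰ), B (nab Φ E) = MaxSet (B E) (f Φ)

/-- Property 1. -/
def Prop1 (f : Profile S ℰ → W → W → Prop) : Prop :=
  ∀ (j k : S) (Ej Ek : ℰ), Ej ≠ Ek →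
    f (Profile.single j Ej) ≠ f (Profile.single k Ek)

/-- Property 2. -/
def Prop2 (B : ℰ → Set W) (f : Profile S ℰ → W → W → Prop) : Prop :=
  ∀ Φ : Profile S ℰ, (⋂ i : {x // x ∈ Φ.soc}, B (Φ.val i)).Nonempty →
    (⋂ i : {x // x ∈ Φ.soc}, B (Φ.val i)) = MaxSet Set.univ (f Φ)

/-- Property 3. -/
def Prop3 [DecidableEq S] (f : Profile S ℰ → W → W → Prop) : Prop :=
  ∀ (Φ : Profile S ℰ) (N₁ N₂ : Finset S) (h₁ : N₁.Nonempty) (h₂ : N₂.Nonempty)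
    (hs₁ : N₁ ⊆ Φ.soc) (hs₂ : N₂ ⊆ Φ.soc),
    Disjoint N₁ N₂ → N₁ ∪ N₂ = Φ.soc → ∀ w w' : W,
      f (Φ.restrict N₁ h₁ hs₁) w w' → f (Φ.restrict N₂ h₂ hs₂) w w' → f Φ w w'

/-- Property 4. -/
def Prop4 [DecidableEq S] (f : Profile S ℰ → W → W → Prop) : Prop :=
  ∀ (Φ : Profile S ℰ) (N₁ N₂ : Finset S) (h₁ : N₁.Nonempty) (h₂ : N₂.Nonempty)
    (hs₁ : N₁ ⊆ Φ.soc) (hs₂ : N₂ ⊆ Φ.soc),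
    Disjoint N₁ N₂ → N₁ ∪ N₂ = Φ.soc → ∀ w w' : W,
      f (Φ.restrict N₁ h₁ hs₁) w w' → StrictRel (f (Φ.restrict N₂ h₂ hs₂)) w w' →
        StrictRel (f Φ) w w'

/-- Property 4′. -/
def Prop4' [DecidableEq S] (f : Profile S ℰ → W → W → Prop) : Prop :=
  ∀ (Φ : Profile S ℰ) (N₁ N₂ : Finset S) (h₁ : N₁.Nonempty) (h₂ : N₂.Nonempty)
    (hs₁ : N₁ ⊆ Φ.soc) (hs₂ : N₂ ⊆ Φ.soc),
    Disjoint N₁ N₂ → N₁ ∪ N₂ = Φ.soc → ∀ w w' : W,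
      StrictRel (f (Φ.restrict N₁ h₁ hs₁)) w w' →
      StrictRel (f (Φ.restrict N₂ h₂ hs₂)) w w' →
        StrictRel (f Φ) w w'

/-- The Maximality Condition. -/
def Maximality (B : ℰ → Set W) (f : Profile S ℰ → W → W → Prop) : Prop :=
  ∀ (i : S) (E : ℰ), B E = MaxSet Set.univ (f (Profile.single i E))

/-- Faithful assignment: basic + Properties 1–4. -/
def IsFaithfulAssignment [LinearOrder S] (B : ℰ → Set W)
    (f : Profile S ℰ → W → W → Prop) : Prop :=
  IsBasicAssignment f ∧ Prop1 f ∧ Prop2 B f ∧ Prop3 f ∧ Prop4 f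

/-- Quasifaithful assignment: basic + Properties 1–3 and 4′. -/
def IsQuasifaithfulAssignment [LinearOrder S] (B : ℰ → Set W)
    (f : Profile S ℰ → W → W → Prop) : Prop :=
  IsBasicAssignment f ∧ Prop1 f ∧ Prop2 B f ∧ Prop3 f ∧ Prop4' f

/-- Property (u). -/
def PropU (f : Profile S ℰ → W → W → Prop) : Prop :=
  ∀ (Φ : Profile S ℰ), (∀ i j : {x // x ∈ Φ.soc}, Φ.val i = Φ.val j) →
    ∀ i : {x // x ∈ Φ.soc}, f Φ = f (Profile.single i.1 (Φ.val i))

/-- Property (p). -/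
def PropP (f : Profile S ℰ → W → W → Prop) : Prop :=
  ∀ (Φ : Profile S ℰ) (w w' : W),
    (∀ i : {x // x ∈ Φ.soc}, StrictRel (f (Profile.single i.1 (Φ.val i))) w w') →
    StrictRel (f Φ) w w'

/-- Two relations coincide on the pair `{w, w'}`. -/
def SameOnPair (R R' : W → W → Prop) (w w' : W) : Prop :=
  (R w w' ↔ R' w w') ∧ (R w' w ↔ R' w' w)

/-- Property (ind). -/
def PropInd (f : Profile S ℰ → W → W → Prop) : Prop :=
  ∀ (N : Finset S) (hN : N.Nonempty) (g g' : {x // x ∈ N} → ℰ) (w w' : W),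
    (∀ i : {x // x ∈ N},
      SameOnPair (f (Profile.single i.1 (g i))) (f (Profile.single i.1 (g' i))) w w') →
    SameOnPair (f ⟨N, hN, g⟩) (f ⟨N, hN, g'⟩) w w'

/-- Property (d). -/
def PropD (f : Profile S ℰ → W → W → Prop) : Prop :=
  ∀ (N : Finset S) (hN : N.Nonempty), ∃ d : {x // x ∈ N},
    ∀ (g : {x // x ∈ N} → ℰ) (w w' : W),
      StrictRel (f (Profile.single d.1 (g d))) w w' → StrictRel (f ⟨N, hN, g⟩) w w'

/-- `D` is a locally decisive `N`-coalition for `E` against `E'`. -/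
def LocallyDecisiveFor (B : ℰ → Set W) (nab : Profile S ℰ → ℰ → ℰ)
    (N : Finset S) (hN : N.Nonempty) (D : Finset S) (hD : D ⊆ N) (E E' : ℰ) : Prop :=
  ∀ f : {x // x ∈ N} → ℰ,
    (∀ i : {x // x ∈ D}, B (nab (Profile.single i.1 (f ⟨i.1, hD i.2⟩)) E) ∩ B E' = ∅) →
    (∀ j : {x // x ∈ N}, j.1 ∉ D → B (nab (Profile.single j.1 (f j)) E) = B E') →
    (⋂ i : {x // x ∈ D}, B (nab (Profile.single i.1 (f ⟨i.1, hD i.2⟩)) E)).Nonempty →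
    B (nab ⟨N, hN, f⟩ E) ∩ B E' = ∅

/-- `D` is a decisive `N`-coalition for `E` against `E'`. -/
def DecisiveFor (B : ℰ → Set W) (nab : Profile S ℰ → ℰ → ℰ)
    (N : Finset S) (hN : N.Nonempty) (D : Finset S) (hD : D ⊆ N) (E E' : ℰ) : Prop :=
  ∀ f : {x // x ∈ N} → ℰ,
    (∀ i : {x // x ∈ D}, B (nab (Profile.single i.1 (f ⟨i.1, hD i.2⟩)) E) ∩ B E' = ∅) →
    (⋂ i : {x // x ∈ D}, B (nab (Profile.single i.1 (f ⟨i.1, hD i.2⟩)) E)).Nonempty →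
    B (nab ⟨N, hN, f⟩ E) ∩ B E' = ∅

/-- `D` is a decisive `N`-coalition. -/
def DecisiveCoalition (B : ℰ → Set W) (nab : Profile S ℰ → ℰ → ℰ)
    (N : Finset S) (hN : N.Nonempty) (D : Finset S) (hD : D ⊆ N) : Prop :=
  ∀ E E' : ℰ, DecisiveFor B nab N hN D hD E E'

end BeliefMerging

namespace BeliefMerging

section Auxiliary

variable {S ℰ W : Type} {B : ℰ → Set W} {nab : Profile S ℰ → ℰ → ℰ}
  {f : Profile S ℰ → W → W → Prop}

/-- The relation revealed by an operator: `a` is revealed at least as good as `b` if it is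
selected from the pair `{a, b}`. -/
def revealed (B : ℰ → Set W) (nab : Profile S ℰ → ℰ → ℰ) (Φ : Profile S ℰ) (a b : W) : Prop :=
  ∃ E : ℰ, B E = {a, b} ∧ a ∈ B (nab Φ E)

lemma mem_maxSet {C : Set W} {R : W → W → Prop} {w : W} :
    w ∈ MaxSet C R ↔ w ∈ C ∧ ∀ w' ∈ C, R w w' := Iff.rfl

/-- An assignment representing an operator is determined by it. -/
lemma Represents.iff_revealed (hsurj : ∀ A : Set W, A.Nonempty → ∃ E : ℰ, B E = A)
    (ha : IsAssignment f) (hr : Represents B nab f) (Φ : Profile S ℰ) (a b : W) :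
    f Φ a b ↔ revealed B nab Φ a b := by
  constructor
  · intro h
    obtain ⟨E, hE⟩ := hsurj {a, b} ⟨a, by simp⟩
    refine ⟨E, hE, ?_⟩
    rw [hr, mem_maxSet, hE]
    refine ⟨by simp, ?_⟩
    rintro w' (rfl | rfl)
    · exact (or_self_iff.mp ((ha Φ).1 _ _))
    · exact h
  · rintro ⟨E, hE, h⟩
    rw [hr, mem_maxSet, hE] at h
    exact h.2 b (by simp)

lemma Represents.eq_revealed (hsurj : ∀ A : Set W, A.Nonempty → ∃ E : ℰ, B E = A)
    (ha : IsAssignment f) (hr : Represents B nab f) : f = revealed B nab := by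
  funext Φ a b
  exact propext (hr.iff_revealed hsurj ha Φ a b)

section OperatorToAssignment

lemma revealed_of_mem (hsurj : ∀ A : Set W, A.Nonempty → ∃ E : ℰ, B E = A)
    (h3 : ESF3 B nab) {Φ : Profile S ℰ} {E : ℰ} {w x : W} (hw : w ∈ B (nab Φ E))
    (hwE : w ∈ B E) (hx : x ∈ B E) : revealed B nab Φ w x := by
  obtain ⟨P, hP⟩ := hsurj {w, x} ⟨w, by simp⟩
  have hPE : B P = B E ∩ B P := by
    rw [hP, eq_comm, Set.inter_eq_right]
    rintro y (rfl | rfl) <;> assumption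
  exact ⟨P, hP, h3 Φ P E P hPE ⟨hw, by simp [hP]⟩⟩

lemma mem_of_revealed (h4 : ESF4 B nab) {Φ : Profile S ℰ} {E : ℰ} {w x : W}
    (hx : x ∈ B (nab Φ E)) (hxE : x ∈ B E) (hwE : w ∈ B E) (h : revealed B nab Φ w x) :
    w ∈ B (nab Φ E) := by
  obtain ⟨P, hP, hw⟩ := h
  have hPE : B P = B E ∩ B P := by
    rw [hP, eq_comm, Set.inter_eq_right]
    rintro y (rfl | rfl) <;> assumption
  exact (h4 Φ P E P hPE ⟨x, hx, by simp [hP]⟩ hw).1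

lemma represents_revealed (hB : ∀ E : ℰ, (B E).Nonempty)
    (hsurj : ∀ A : Set W, A.Nonempty → ∃ E : ℰ, B E = A)
    (h1 : ESF1 B nab) (h3 : ESF3 B nab) (h4 : ESF4 B nab) :
    Represents B nab (revealed B nab) := by
  intro Φ E
  ext w
  constructor
  · exact fun hw => ⟨h1 Φ E hw, fun x hx => revealed_of_mem hsurj h3 hw (h1 Φ E hw) hx⟩
  · rintro ⟨hwE, hw⟩
    obtain ⟨x, hx⟩ := hB (nab Φ E)
    exact mem_of_revealed h4 hx (h1 Φ E hx) hwE (hw x (h1 Φ E hx))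

lemma isAssignment_revealed (hB : ∀ E : ℰ, (B E).Nonempty)
    (hsurj : ∀ A : Set W, A.Nonempty → ∃ E : ℰ, B E = A)
    (h1 : ESF1 B nab) (h3 : ESF3 B nab) (h4 : ESF4 B nab) :
    IsAssignment (revealed B nab) := by
  intro Φ
  refine ⟨fun a b => ?_, fun a b c hab hbc => ?_⟩
  · obtain ⟨E, hE⟩ := hsurj {a, b} ⟨a, by simp⟩
    obtain ⟨x, hx⟩ := hB (nab Φ E)
    have hxE := h1 Φ E hx
    rw [hE] at hxE
    rcases hxE with rfl | rfl
    · exact Or.inl ⟨E, hE, hx⟩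
    · exact Or.inr ⟨E, hE.trans (Set.pair_comm _ _), hx⟩
  · obtain ⟨E, hE⟩ := hsurj {a, b, c} ⟨a, by simp⟩
    have haE : a ∈ B E := by simp [hE]
    have hbE : b ∈ B E := by simp [hE]
    have hcE : c ∈ B E := by simp [hE]
    have hba : b ∈ B (nab Φ E) → a ∈ B (nab Φ E) :=
      fun h => mem_of_revealed h4 h hbE haE hab
    have ha : a ∈ B (nab Φ E) := by
      obtain ⟨x, hx⟩ := hB (nab Φ E)
      have hxE := h1 Φ E hx
      rw [hE] at hxE
      rcases hxE with rfl | rfl | rfl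
      · exact hx
      · exact hba hx
      · exact hba (mem_of_revealed h4 hx hcE hbE hbc)
    exact revealed_of_mem hsurj h3 ha haE hcE

lemma prop1_of_represents (hr : Represents B nab f) (h5 : ESF5 B nab) : Prop1 f := by
  intro j k Ej Ek hne hf
  obtain ⟨E, hE⟩ := h5 j k Ej Ek hne
  exact hE (by rw [hr, hr, hf])

lemma prop2_of_represents [Nonempty W]
    (hsurj : ∀ A : Set W, A.Nonempty → ∃ E : ℰ, B E = A)
    (hr : Represents B nab f) (h6 : ESF6 B nab) : Prop2 B f := by
  intro Φ hne
  obtain ⟨E, hE⟩ := hsurj Set.univ Set.univ_nonempty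
  have h := h6 Φ E (by rwa [hE, Set.inter_univ])
  rw [hr, hE, Set.inter_univ] at h
  exact h.symm

variable [DecidableEq S]

lemma prop3_of_represents (hsurj : ∀ A : Set W, A.Nonempty → ∃ E : ℰ, B E = A)
    (ha : IsAssignment f) (hr : Represents B nab f) (h7 : ESF7 B nab) : Prop3 f := by
  intro Φ N₁ N₂ h₁ h₂ hs₁ hs₂ hd hu w w' hw₁ hw₂
  obtain ⟨E, hE⟩ := hsurj {w, w'} ⟨w, by simp⟩
  have hmem : ∀ Ψ : Profile S ℰ, f Ψ w w' → w ∈ B (nab Ψ E) := by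
    intro Ψ h
    rw [hr, mem_maxSet, hE]
    refine ⟨by simp, ?_⟩
    rintro x (rfl | rfl)
    · exact or_self_iff.mp ((ha Ψ).1 _ _)
    · exact h
  have h := h7 Φ N₁ N₂ h₁ h₂ hs₁ hs₂ hd hu E ⟨hmem _ hw₁, hmem _ hw₂⟩
  rw [hr, mem_maxSet, hE] at h
  exact h.2 w' (by simp)

lemma prop4_of_represents (hsurj : ∀ A : Set W, A.Nonempty → ∃ E : ℰ, B E = A)
    (ha : IsAssignment f) (hr : Represents B nab f) (h7 : ESF7 B nab) (h8 : ESF8 B nab) :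
    Prop4 f := by
  intro Φ N₁ N₂ h₁ h₂ hs₁ hs₂ hd hu w w' hw₁ hw₂
  refine ⟨prop3_of_represents hsurj ha hr h7 Φ N₁ N₂ h₁ h₂ hs₁ hs₂ hd hu w w' hw₁ hw₂.1,
    fun hw' => hw₂.2 ?_⟩
  obtain ⟨E, hE⟩ := hsurj {w, w'} ⟨w, by simp⟩
  have hrefl : ∀ (Ψ : Profile S ℰ) (x : W), f Ψ x x :=
    fun Ψ x => or_self_iff.mp ((ha Ψ).1 x x)
  have hmem : ∀ Ψ : Profile S ℰ, f Ψ w w' → w ∈ B (nab Ψ E) := by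
    intro Ψ h
    rw [hr, mem_maxSet, hE]
    refine ⟨by simp, ?_⟩
    rintro x (rfl | rfl)
    · exact hrefl _ _
    · exact h
  have hmem' : w' ∈ B (nab Φ E) := by
    rw [hr, mem_maxSet, hE]
    refine ⟨by simp, ?_⟩
    rintro x (rfl | rfl)
    · exact hw'
    · exact hrefl _ _
  have h := (h8 Φ N₁ N₂ h₁ h₂ hs₁ hs₂ hd hu E ⟨w, hmem _ hw₁, hmem _ hw₂.1⟩ hmem').2
  rw [hr, mem_maxSet, hE] at h
  exact h.2 w (by simp)

end OperatorToAssignment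

lemma isBasicAssignment_revealed [LinearOrder S] (hB : ∀ E : ℰ, (B E).Nonempty)
    (hsurj : ∀ A : Set W, A.Nonempty → ∃ E : ℰ, B E = A) (h : BasicFusion B nab) :
    IsBasicAssignment (revealed B nab) := by
  obtain ⟨h1, h2, h3, h4⟩ := h
  refine ⟨isAssignment_revealed hB hsurj h1 h3 h4, fun Φ Ψ hΦ => ?_⟩
  funext a b
  simp only [revealed, h2 Φ Ψ _ _ hΦ rfl]

section AssignmentToOperator

lemma maxSet_inter_subset (C D : Set W) (R : W → W → Prop) :
    MaxSet C R ∩ D ⊆ MaxSet (C ∩ D) R :=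
  fun _ hw => ⟨⟨hw.1.1, hw.2⟩, fun x hx => hw.1.2 x hx.1⟩

lemma maxSet_inter_eq {C D : Set W} {R : W → W → Prop}
    (htrans : ∀ a b c, R a b → R b c → R a c) (hne : (MaxSet C R ∩ D).Nonempty) :
    MaxSet (C ∩ D) R = MaxSet C R ∩ D := by
  refine Set.Subset.antisymm ?_ (maxSet_inter_subset C D R)
  obtain ⟨x, hx, hxD⟩ := hne
  rintro w ⟨hw, hmax⟩
  exact ⟨⟨hw.1, fun y hy => htrans _ _ _ (hmax x ⟨hx.1, hxD⟩) (hx.2 y hy)⟩, hw.2⟩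

lemma basicFusion_of_represents [LinearOrder S] (hf : IsBasicAssignment f)
    (hr : Represents B nab f) : BasicFusion B nab := by
  refine ⟨?_, ?_, ?_, ?_⟩
  · intro Φ E
    rw [hr]
    exact fun _ hw => hw.1
  · intro Φ Φ' E E' hΦ hE
    rw [hr, hr, hf.2 Φ Φ' hΦ, hE]
  · intro Φ E E' E'' hE
    rw [hr, hr, hE]
    exact maxSet_inter_subset _ _ _
  · intro Φ E E' E'' hE hne
    rw [hr] at hne
    rw [hr, hr, hE, maxSet_inter_eq (hf.1 Φ).2 hne]

lemma esf5_of_represents (hsurj : ∀ A : Set W, A.Nonempty → ∃ E : ℰ, B E = A)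
    (ha : IsAssignment f) (hr : Represents B nab f) (h1 : Prop1 f) : ESF5 B nab := by
  intro j k Ej Ek hne
  by_contra! h
  refine h1 j k Ej Ek hne ?_
  funext a b
  rw [hr.eq_revealed hsurj ha]
  simp only [revealed, h]

lemma esf6_of_represents (ha : IsAssignment f) (hr : Represents B nab f) (h2 : Prop2 B f) :
    ESF6 B nab := by
  intro Φ E hne
  have h := h2 Φ (hne.mono Set.inter_subset_left)
  rw [h] at hne ⊢
  rw [hr, ← maxSet_inter_eq (ha Φ).2 hne, Set.univ_inter]

variable [DecidableEq S]

lemma esf7_of_represents (hr : Represents B nab f) (h3 : Prop3 f) : ESF7 B nab := by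
  intro Φ N₁ N₂ h₁ h₂ hs₁ hs₂ hd hu E
  rw [hr, hr, hr]
  exact fun w hw => ⟨hw.1.1, fun x hx =>
    h3 Φ N₁ N₂ h₁ h₂ hs₁ hs₂ hd hu w x (hw.1.2 x hx) (hw.2.2 x hx)⟩

lemma esf8_of_represents (ha : IsAssignment f) (hr : Represents B nab f) (h4 : Prop4 f) :
    ESF8 B nab := by
  have key : ∀ (Φ : Profile S ℰ) (N₁ N₂ : Finset S) (h₁ : N₁.Nonempty) (h₂ : N₂.Nonempty)
      (hs₁ : N₁ ⊆ Φ.soc) (hs₂ : N₂ ⊆ Φ.soc), Disjoint N₁ N₂ → N₁ ∪ N₂ = Φ.soc →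
      ∀ (C : Set W) (x w : W), x ∈ MaxSet C (f (Φ.restrict N₁ h₁ hs₁)) →
        x ∈ MaxSet C (f (Φ.restrict N₂ h₂ hs₂)) → w ∈ MaxSet C (f Φ) →
        w ∈ MaxSet C (f (Φ.restrict N₂ h₂ hs₂)) := by
    intro Φ N₁ N₂ h₁ h₂ hs₁ hs₂ hd hu C x w hx₁ hx₂ hw
    have hwx : f (Φ.restrict N₂ h₂ hs₂) w x := by
      by_contra hcon
      exact (h4 Φ N₁ N₂ h₁ h₂ hs₁ hs₂ hd hu x w (hx₁.2 w hw.1)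
        ⟨hx₂.2 w hw.1, hcon⟩).2 (hw.2 x hx₁.1)
    exact ⟨hw.1, fun y hy => (ha _).2 _ _ _ hwx (hx₂.2 y hy)⟩
  intro Φ N₁ N₂ h₁ h₂ hs₁ hs₂ hd hu E
  rw [hr, hr, hr]
  rintro ⟨x, hx₁, hx₂⟩ w hw
  exact ⟨key Φ N₂ N₁ h₂ h₁ hs₂ hs₁ hd.symm (by rwa [Finset.union_comm]) _ x w hx₂ hx₁ hw,
    key Φ N₁ N₂ h₁ h₂ hs₁ hs₂ hd hu _ x w hx₁ hx₂ hw⟩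

end AssignmentToOperator

end Auxiliary

end BeliefMerging

open BeliefMerging in
/-- Weak representation theorem for ES fusion operators. -/
theorem weak_representation_fusion
    {S ℰ W : Type} [LinearOrder S] [Nonempty S] [Fintype W] [Nonempty W]
    (B : ℰ → Set W) (hB : ∀ E : ℰ, (B E).Nonempty)
    (hsurj : ∀ A : Set W, A.Nonempty → ∃ E : ℰ, B E = A)
    (nab : Profile S ℰ → ℰ → ℰ) :
    Fusion B nab ↔
      ∃! f : Profile S ℰ → W → W → Prop,
        IsFaithfulAssignment B f ∧ Represents B nab f := by
  constructor
  · rintro ⟨hbasic, h5, h6, h7, h8⟩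
    have hf := isBasicAssignment_revealed hB hsurj hbasic
    have hr := represents_revealed hB hsurj hbasic.1 hbasic.2.2.1 hbasic.2.2.2
    exact ⟨revealed B nab,
      ⟨⟨hf, prop1_of_represents hr h5, prop2_of_represents hsurj hr h6,
        prop3_of_represents hsurj hf.1 hr h7, prop4_of_represents hsurj hf.1 hr h7 h8⟩, hr⟩,
      fun g hg => hg.2.eq_revealed hsurj hg.1.1.1⟩
  · rintro ⟨f, ⟨⟨hf, h1, h2, h3, h4⟩, hr⟩, -⟩
    exact ⟨basicFusion_of_represents hf hr, esf5_of_represents hsurj hf.1 hr h1,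
      esf6_of_represents hf.1 hr h2, esf7_of_represents hr h3, esf8_of_represents hf.1 hr h4⟩
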